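/- In the chain of loops Γ₀ with marked points v_g ∈ γ₁ and v_{g−1} ∈ γ_a: let R₁, …, R_a be points with R₁ ∈ γ₁ \ {v_g, w₁}, R_i ∈ γ_i \ {w_{i−1}, w_i} for 2 ≤ i ≤ a − 1, and R_a ∈ γ_a \ {w_{a−1}, v_{g−1}}. Then the divisor R₁ + ⋯ + R_a + v_{g−1} is v_{g−1}-reduced on Γ₀; consequently rk_{Γ₀}(R₁ + ⋯ + R_a − v_{g−1}) = −1, i.e. R₁ + ⋯ + R_a − v_{g−1} is not linearly equivalent to an effective divisor on Γ₀. -/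

import Mathlib

noncomputable section

/-- The star with `n` rays of radius `r` in the complex plane:
`{ z ∈ ℂ : z = t·e^{2πik/n}, t ∈ [0,r], k ∈ ℤ }`. -/
def starSet (n : ℕ) (r : ℝ) : Set ℂ :=
  {z | ∃ t ∈ Set.Icc (0 : ℝ) r, ∃ k : ℤ,
    z = (t : ℂ) * Complex.exp (2 * (Real.pi : ℂ) * Complex.I * (k : ℂ) / (n : ℂ))}

/-- `P` has a neighbourhood isometric to a star with `n` rays of some radius `r > 0`,
with `P` corresponding to `0`. -/
def HasStarNbhd (Γ : Type*) [MetricSpace Γ] (P : Γ) (n : ℕ) : Prop :=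
  ∃ r > (0 : ℝ), ∃ U ∈ nhds P, ∃ φ : Γ → ℂ,
    φ P = 0 ∧ φ '' U = starSet n r ∧
    ∀ x ∈ U, ∀ y ∈ U, dist (φ x) (φ y) = dist x y

/-- A metric graph: a compact connected metric space in which every point has a
neighbourhood isometric to a star with `n ≥ 1` rays. -/
def IsMetricGraph (Γ : Type*) [MetricSpace Γ] : Prop :=
  CompactSpace Γ ∧ ConnectedSpace Γ ∧ ∀ P : Γ, ∃ n : ℕ, 1 ≤ n ∧ HasStarNbhd Γ P n

/-- The valence of a point: the number of rays of a star neighbourhood. -/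
noncomputable def valence (Γ : Type*) [MetricSpace Γ] (P : Γ) : ℕ :=
  sInf {n : ℕ | 1 ≤ n ∧ HasStarNbhd Γ P n}

/-- A vertex is a point of valence different from `2`. -/
def IsVertex (Γ : Type*) [MetricSpace Γ] (P : Γ) : Prop := valence Γ P ≠ 2

/-- The genus of a metric graph: `#edges - #vertices + 1`, the edges being the connected
components of the complement of the vertex set. -/
noncomputable def graphGenus (Γ : Type*) [MetricSpace Γ] : ℤ :=
  (Nat.card (ConnectedComponents {P : Γ // ¬ IsVertex Γ P}) : ℤ)
    - (Nat.card {P : Γ // IsVertex Γ P} : ℤ) + 1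

/-- A divisor on `Γ` : a finitely supported formal `ℤ`-linear combination of points. -/
abbrev Divisor (Γ : Type*) : Type _ := Γ →₀ ℤ

/-- The degree of a divisor. -/
def divDeg {Γ : Type*} (D : Divisor Γ) : ℤ := D.sum fun _ n => n

/-- A divisor is effective if all its coefficients are nonnegative. -/
def Effective {Γ : Type*} (D : Divisor Γ) : Prop := ∀ P : Γ, 0 ≤ D P

/-- An arc based at `P` : an isometric parametrization of a segment emanating from `P`. -/
def IsArcAt {Γ : Type*} [MetricSpace Γ] (P : Γ) (τ : ℝ → Γ) : Prop :=
  τ 0 = P ∧ ∃ a > (0 : ℝ), ∀ s ∈ Set.Icc (0 : ℝ) a, ∀ t ∈ Set.Icc (0 : ℝ) a,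
    dist (τ s) (τ t) = |s - t|

/-- Two arcs are equivalent (define the same tangent direction) when they agree near `0`. -/
def ArcEquiv {Γ : Type*} (τ τ' : ℝ → Γ) : Prop :=
  ∃ ε > (0 : ℝ), ∀ t ∈ Set.Icc (0 : ℝ) ε, τ t = τ' t

/-- `f` has (one-sided) slope `s` along the arc `τ`. -/
def HasSlopeAlong {Γ : Type*} (f : Γ → ℝ) (τ : ℝ → Γ) (s : ℤ) : Prop :=
  ∃ ε > (0 : ℝ), ∀ t ∈ Set.Icc (0 : ℝ) ε, f (τ t) = f (τ 0) + (s : ℝ) * t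

/-- A rational function on a metric graph: continuous and piecewise affine with
integer slopes, i.e. having an integer slope along every arc. -/
def IsRational (Γ : Type*) [MetricSpace Γ] (f : Γ → ℝ) : Prop :=
  Continuous f ∧ ∀ (P : Γ) (τ : ℝ → Γ), IsArcAt P τ → ∃ s : ℤ, HasSlopeAlong f τ s

/-- `div f` has coefficient `m` at `P`: the sum of the slopes of `f` in all tangent
directions emanating from `P` equals `m`. -/
def HasOrderAt (Γ : Type*) [MetricSpace Γ] (f : Γ → ℝ) (P : Γ) (m : ℤ) : Prop :=
  ∃ (n : ℕ) (τ : Fin n → ℝ → Γ) (s : Fin n → ℤ),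
    (∀ i, IsArcAt P (τ i)) ∧
    Pairwise (fun i j => ¬ ArcEquiv (τ i) (τ j)) ∧
    (∀ σ : ℝ → Γ, IsArcAt P σ → ∃ i, ArcEquiv σ (τ i)) ∧
    (∀ i, HasSlopeAlong f (τ i) (s i)) ∧
    m = ∑ i, s i

/-- Linear equivalence of divisors: `D₂ - D₁ = div f` for some rational function `f`. -/
def LinEquiv (Γ : Type*) [MetricSpace Γ] (D₁ D₂ : Divisor Γ) : Prop :=
  ∃ f : Γ → ℝ, IsRational Γ f ∧ ∀ P : Γ, HasOrderAt Γ f P (D₂ P - D₁ P)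

/-- `D` is linearly equivalent to an effective divisor. -/
def EquivEffective (Γ : Type*) [MetricSpace Γ] (D : Divisor Γ) : Prop :=
  ∃ D' : Divisor Γ, Effective D' ∧ LinEquiv Γ D D'

/-- For every effective divisor `E` of degree `r`, `D - E` is linearly equivalent to an
effective divisor. -/
def RankGE (Γ : Type*) [MetricSpace Γ] (D : Divisor Γ) (r : ℕ) : Prop :=
  ∀ E : Divisor Γ, Effective E → divDeg E = (r : ℤ) → EquivEffective Γ (D - E)

/-- The rank of a divisor: `-1` if `D` is not equivalent to an effective divisor, and
otherwise the largest `r ≥ 0` such that `D - E` is equivalent to an effective divisor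
for every effective `E` of degree `r`. -/
noncomputable def divRank (Γ : Type*) [MetricSpace Γ] (D : Divisor Γ) : ℤ :=
  sSup (insert (-1) {n : ℤ | ∃ r : ℕ, n = (r : ℤ) ∧ RankGE Γ D r})

/-- The arc `τ` immediately leaves the set `X`. -/
def ArcLeaves {Γ : Type*} (X : Set Γ) (τ : ℝ → Γ) : Prop :=
  ∃ ε > (0 : ℝ), ∀ t ∈ Set.Ioc (0 : ℝ) ε, τ t ∉ X

/-- `P` is a non-saturated boundary point of `X` with respect to `D` : the number of
tangent directions at `P` leaving `X` is strictly greater than `D P`. -/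
def NonSaturated (Γ : Type*) [MetricSpace Γ] (D : Divisor Γ) (X : Set Γ) (P : Γ) : Prop :=
  P ∈ frontier X ∧ ∃ (n : ℕ) (τ : Fin n → ℝ → Γ),
    (∀ i, IsArcAt P (τ i)) ∧ (∀ i, ArcLeaves X (τ i)) ∧
    Pairwise (fun i j => ¬ ArcEquiv (τ i) (τ j)) ∧ D P < (n : ℤ)

/-- `D` is `P₀`-reduced. -/
def IsReducedDivisor (Γ : Type*) [MetricSpace Γ] (D : Divisor Γ) (P₀ : Γ) : Prop :=
  (∀ P : Γ, P ≠ P₀ → 0 ≤ D P) ∧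
  ∀ X : Set Γ, IsClosed X → X.Nonempty → P₀ ∉ X → ∃ P, NonSaturated Γ D X P

/-- The restriction of a divisor on `Γ` to a divisor on a subset `S` (with the induced
metric); divisors supported on `S` are identified with divisors on `S` this way. -/
noncomputable def DivRestrict {Γ : Type*} (S : Set Γ) (D : Divisor Γ) : Divisor ↥S :=
  Finsupp.comapDomain Subtype.val D Subtype.coe_injective.injOn

/-- Linear equivalence computed on the subgraph `S` of `Γ`. -/
def LinEquivOn {Γ : Type*} [MetricSpace Γ] (S : Set Γ) (D₁ D₂ : Divisor Γ) : Prop :=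
  LinEquiv ↥S (DivRestrict S D₁) (DivRestrict S D₂)

/-- The rank computed on the subgraph `S` of `Γ`. -/
noncomputable def divRankOn {Γ : Type*} [MetricSpace Γ] (S : Set Γ) (D : Divisor Γ) : ℤ :=
  divRank ↥S (DivRestrict S D)

/-- A free divisor: effective, of rank at least one, and removing any point decreases
the rank. -/
def IsFreeDivisor (Γ : Type*) [MetricSpace Γ] (D : Divisor Γ) : Prop :=
  Effective D ∧ 1 ≤ divRank Γ D ∧
  ∀ P : Γ, divRank Γ (D - Finsupp.single P 1) < divRank Γ D

/-- The canonical divisor `K_Γ = Σ_P (val(P) - 2)·P`. -/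
def IsCanonical (Γ : Type*) [MetricSpace Γ] (K : Divisor Γ) : Prop :=
  ∀ P : Γ, K P = (valence Γ P : ℤ) - 2

/-- A very special divisor: effective with `rk(D) > 0` and `rk(K_Γ - D) > 0`. -/
def VerySpecial (Γ : Type*) [MetricSpace Γ] (D : Divisor Γ) : Prop :=
  Effective D ∧ 0 < divRank Γ D ∧
  ∃ K : Divisor Γ, IsCanonical Γ K ∧ 0 < divRank Γ (K - D)

/-- `φ` is an `L`-periodic locally isometric parametrization of the circle `S ⊆ Γ`
of circumference `L`. -/
def CircleParam {Γ : Type*} [MetricSpace Γ] (S : Set Γ) (L : ℝ) (φ : ℝ → Γ) : Prop :=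
  0 < L ∧ (∀ t : ℝ, φ (t + L) = φ t) ∧ Set.range φ = S ∧
  ∀ s t : ℝ, |s - t| ≤ L / 2 → dist (φ s) (φ t) = |s - t|

/-- `S` is a metric circle inside `Γ`. -/
def IsCircleSet {Γ : Type*} [MetricSpace Γ] (S : Set Γ) : Prop :=
  ∃ (L : ℝ) (φ : ℝ → Γ), CircleParam S L φ

end
/-- A bundled metric graph. -/
structure MetricGraph : Type 1 where
  carrier : Type
  [ms : MetricSpace carrier]
  graph : IsMetricGraph carrier

attribute [instance] MetricGraph.ms

/-- A metric graph `G` obtained from a metric graph `G₀` by attaching a loop `γ`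
(a metric circle) at a point `v ∈ G₀`. -/
structure LoopAttachment : Type 1 where
  G : Type
  [ms : MetricSpace G]
  graph : IsMetricGraph G
  G₀ : Set G
  γ : Set G
  v : G
  hv : v ∈ G₀
  closed₀ : IsClosed G₀
  closedγ : IsClosed γ
  cover : G₀ ∪ γ = Set.univ
  meet : G₀ ∩ γ = {v}
  graph₀ : IsMetricGraph ↥G₀
  circleγ : IsCircleSet γ

attribute [instance] LoopAttachment.ms
/-- A chain of `a` loops `γ₁, …, γ_a` with consecutive loops meeting in the points
`w₁, …, w_{a-1}`, together with marked points `vg ∈ γ₁ \ {w₁}` and `vg' ∈ γ_a \ {w_{a-1}}`. -/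
structure ChainOfLoops (a : ℕ) : Type 1 where
  ha : 1 ≤ a
  Γ : Type
  [ms : MetricSpace Γ]
  graph : IsMetricGraph Γ
  loop : ℕ → Set Γ
  w : ℕ → Γ
  vg : Γ
  vg' : Γ
  circle : ∀ i ∈ Finset.Icc 1 a, IsCircleSet (loop i)
  closedLoop : ∀ i ∈ Finset.Icc 1 a, IsClosed (loop i)
  cover : (⋃ i ∈ Finset.Icc 1 a, loop i) = Set.univ
  chainMeet : ∀ i ∈ Finset.Icc 1 (a - 1), loop i ∩ loop (i + 1) = {w i}
  chainDisj : ∀ i ∈ Finset.Icc 1 a, ∀ j ∈ Finset.Icc 1 a, i + 2 ≤ j → loop i ∩ loop j = ∅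
  hvg : vg ∈ loop 1
  hvg' : vg' ∈ loop a
  hvgw : 2 ≤ a → vg ≠ w 1
  hvg'w : 2 ≤ a → vg' ≠ w (a - 1)

attribute [instance] ChainOfLoops.ms

/-- The chain-plus-loops graph: a chain `Γ₀` of `a` loops (with the genericity condition
that the two edges joining `w_i` to `w_{i+1}` have different lengths), marked points
`v_{a+1}, …, v_g` on `Γ₀` (with `v_g ∈ γ₁ \ {w₁}`, `2v_g ≁ 2w₁` on `γ₁`, and
`v_{g-1} ∈ γ_a \ {w_{a-1}}`, `2v_{g-1} ≁ 2w_{a-1}` on `γ_a`), and a loop `γ_i`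
attached at `v_i` for each `a + 1 ≤ i ≤ g`. -/
structure ChainPlusLoops (a g : ℕ) : Type 1 where
  ha : 1 ≤ a
  hg : a + 3 ≤ g
  Γ : Type
  [ms : MetricSpace Γ]
  graph : IsMetricGraph Γ
  loop : ℕ → Set Γ
  w : ℕ → Γ
  v : ℕ → Γ
  Γ₀ : Set Γ
  hΓ₀ : Γ₀ = ⋃ i ∈ Finset.Icc 1 a, loop i
  circle : ∀ i ∈ Finset.Icc 1 g, IsCircleSet (loop i)
  closedLoop : ∀ i ∈ Finset.Icc 1 g, IsClosed (loop i)
  chainMeet : ∀ i ∈ Finset.Icc 1 (a - 1), loop i ∩ loop (i + 1) = {w i}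
  chainDisj : ∀ i ∈ Finset.Icc 1 a, ∀ j ∈ Finset.Icc 1 a, i + 2 ≤ j → loop i ∩ loop j = ∅
  edgeLengths : ∀ i ∈ Finset.Icc 1 (a - 2), ∃ (L : ℝ) (φ : ℝ → Γ) (l : ℝ),
    CircleParam (loop (i + 1)) L φ ∧ φ 0 = w i ∧ 0 < l ∧ l < L ∧ φ l = w (i + 1) ∧ 2 * l ≠ L
  cover : Γ₀ ∪ (⋃ i ∈ Finset.Icc (a + 1) g, loop i) = Set.univ
  hvg : v g ∈ loop 1
  hvg' : v (g - 1) ∈ loop a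
  hvgw : 2 ≤ a → v g ≠ w 1
  hvg'w : 2 ≤ a → v (g - 1) ≠ w (a - 1)
  vgGeneric : 2 ≤ a →
    ¬ LinEquivOn (loop 1) (Finsupp.single (v g) 2) (Finsupp.single (w 1) 2)
  vg'Generic : 2 ≤ a →
    ¬ LinEquivOn (loop a) (Finsupp.single (v (g - 1)) 2) (Finsupp.single (w (a - 1)) 2)
  hvMem : ∀ i ∈ Finset.Icc (a + 1) g, v i ∈ Γ₀
  hvInj : ∀ i ∈ Finset.Icc (a + 1) g, ∀ j ∈ Finset.Icc (a + 1) g, i ≠ j → v i ≠ v j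
  hvw : ∀ i ∈ Finset.Icc (a + 1) g, ∀ k ∈ Finset.Icc 1 (a - 1), v i ≠ w k
  attachMeet : ∀ i ∈ Finset.Icc (a + 1) g, loop i ∩ Γ₀ = {v i}
  attachDisj : ∀ i ∈ Finset.Icc (a + 1) g, ∀ j ∈ Finset.Icc (a + 1) g, i ≠ j →
    loop i ∩ loop j = ∅
  graph₀ : IsMetricGraph ↥Γ₀
  hGenus : graphGenus Γ = (g : ℤ)

attribute [instance] ChainPlusLoops.ms

section Arcs

variable {Γ : Type*}

theorem ArcEquiv.symm {τ τ' : ℝ → Γ} (h : ArcEquiv τ τ') : ArcEquiv τ' τ := by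
  obtain ⟨ε, hε, h⟩ := h
  exact ⟨ε, hε, fun t ht => (h t ht).symm⟩

theorem ArcEquiv.trans {τ τ' τ'' : ℝ → Γ} (h : ArcEquiv τ τ') (h' : ArcEquiv τ' τ'') :
    ArcEquiv τ τ'' := by
  obtain ⟨ε, hε, h⟩ := h
  obtain ⟨δ, hδ, h'⟩ := h'
  refine ⟨min ε δ, lt_min hε hδ, fun t ht => ?_⟩
  rw [h t ⟨ht.1, ht.2.trans (min_le_left _ _)⟩, h' t ⟨ht.1, ht.2.trans (min_le_right _ _)⟩]

theorem ArcLeaves.congr {X : Set Γ} {τ τ' : ℝ → Γ} (h : ArcLeaves X τ) (e : ArcEquiv τ τ') :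
    ArcLeaves X τ' := by
  obtain ⟨ε, hε, h⟩ := h
  obtain ⟨δ, hδ, e⟩ := e
  refine ⟨min ε δ, lt_min hε hδ, fun t ht => ?_⟩
  rw [← e t ⟨ht.1.le, ht.2.trans (min_le_right _ _)⟩]
  exact h t ⟨ht.1, ht.2.trans (min_le_left _ _)⟩

/-- At a maximum of `f` every slope is nonpositive. -/
theorem HasSlopeAlong.nonpos_of_isMax {f : Γ → ℝ} {τ : ℝ → Γ} {s : ℤ} (h : HasSlopeAlong f τ s)
    (hmax : ∀ x, f x ≤ f (τ 0)) : s ≤ 0 := by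
  obtain ⟨ε, hε, h⟩ := h
  have h1 := h ε ⟨hε.le, le_rfl⟩
  have h2 := hmax (τ ε)
  have h3 : (s : ℝ) ≤ 0 := by
    by_contra! hs
    nlinarith [mul_pos hs hε]
  exact_mod_cast h3

/-- At a maximum of `f` the slope along an arc leaving the locus of maxima is negative. -/
theorem HasSlopeAlong.neg_of_leaves_argmax {f : Γ → ℝ} {τ : ℝ → Γ} {s : ℤ}
    (h : HasSlopeAlong f τ s) (hmax : ∀ x, f x ≤ f (τ 0))
    (hl : ArcLeaves {x | f x = f (τ 0)} τ) : s ≤ -1 := by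
  have h0 := h.nonpos_of_isMax hmax
  have hne : s ≠ 0 := by
    rintro rfl
    obtain ⟨ε, hε, h⟩ := h
    obtain ⟨δ, hδ, hl⟩ := hl
    have hm : 0 < min ε δ := lt_min hε hδ
    refine hl (min ε δ) ⟨hm, min_le_right _ _⟩ ?_
    simpa using h (min ε δ) ⟨hm.le, min_le_left _ _⟩
  omega

variable [MetricSpace Γ]

theorem mem_frontier_of_arcLeaves {X : Set Γ} {P : Γ} (hP : P ∈ X)
    {τ : ℝ → Γ} (hτ : IsArcAt P τ) (hl : ArcLeaves X τ) : P ∈ frontier X := by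
  refine ⟨subset_closure hP, fun hPint => ?_⟩
  obtain ⟨r, hr, hball⟩ := Metric.isOpen_iff.1 isOpen_interior P hPint
  obtain ⟨h0, a, ha, hiso⟩ := hτ
  obtain ⟨ε, hε, hl⟩ := hl
  set t := min (min a ε) (r / 2) with ht
  have htpos : 0 < t := lt_min (lt_min ha hε) (half_pos hr)
  have hta : t ≤ a := (min_le_left _ _).trans (min_le_left _ _)
  have htε : t ≤ ε := (min_le_left _ _).trans (min_le_right _ _)
  have htr : t ≤ r / 2 := min_le_right _ _
  refine hl t ⟨htpos, htε⟩ (interior_subset (hball ?_))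
  have hd := hiso t ⟨htpos.le, hta⟩ 0 ⟨le_rfl, ha.le⟩
  rw [h0, sub_zero, abs_of_pos htpos] at hd
  rw [Metric.mem_ball, hd]
  linarith

/-- At a maximum of `f`, the order of `f` is at most minus the number of tangent directions
leaving the locus of maxima. -/
theorem HasOrderAt.le_neg_of_leaves_argmax {f : Γ → ℝ} {P : Γ} {m : ℤ} (h : HasOrderAt Γ f P m)
    (hmax : ∀ x, f x ≤ f P) {n : ℕ} {σ : Fin n → ℝ → Γ} (harc : ∀ i, IsArcAt P (σ i))
    (hl : ∀ i, ArcLeaves {x | f x = f P} (σ i))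
    (hpw : Pairwise fun i j => ¬ ArcEquiv (σ i) (σ j)) : m ≤ -(n : ℤ) := by
  obtain ⟨k, τ, s, hτ, -, hall, hs, rfl⟩ := h
  choose g hg using fun i => hall (σ i) (harc i)
  have ginj : Function.Injective g := by
    intro i j hij
    by_contra hne
    exact hpw hne ((hg i).trans (hij ▸ (hg j).symm))
  have h0 : ∀ i, τ i 0 = P := fun i => (hτ i).1
  calc ∑ i, s i ≤ ∑ i ∈ Finset.univ.image g, s i := by
        refine Finset.sum_le_sum_of_subset_of_nonpos' (Finset.subset_univ _) fun i _ _ => ?_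
        exact (hs i).nonpos_of_isMax (by simpa [h0] using hmax)
    _ = ∑ j, s (g j) := Finset.sum_image fun i _ j _ hij => ginj hij
    _ ≤ ∑ _j : Fin n, (-1 : ℤ) := by
        refine Finset.sum_le_sum fun j _ => (hs (g j)).neg_of_leaves_argmax ?_ ?_
        · simpa [h0] using hmax
        · simpa [h0] using (hl j).congr (hg j)
    _ = -(n : ℤ) := by simp

end Arcs

section Circles

variable {Γ : Type*} [MetricSpace Γ] {S : Set Γ} {L : ℝ} {φ : ℝ → Γ}

theorem CircleParam.continuous (h : CircleParam S L φ) : Continuous φ := by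
  obtain ⟨hL, -, -, hiso⟩ := h
  refine Metric.continuous_iff.2 fun b ε hε => ⟨min ε (L / 2), lt_min hε (half_pos hL), ?_⟩
  intro a hab
  rw [Real.dist_eq] at hab
  rw [hiso a b (hab.le.trans (min_le_right _ _))]
  exact hab.trans_le (min_le_left _ _)

theorem CircleParam.isArcAt_add (h : CircleParam S L φ) (c : ℝ) :
    IsArcAt (φ c) fun t => φ (c + t) := by
  refine ⟨by simp, L / 2, half_pos h.1, fun s hs t ht => ?_⟩
  have e : c + s - (c + t) = s - t := by ring
  dsimp only
  rw [h.2.2.2 (c + s) (c + t), e]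
  rw [e, abs_le]
  constructor <;> linarith [hs.1, hs.2, ht.1, ht.2]

theorem CircleParam.isArcAt_sub (h : CircleParam S L φ) (c : ℝ) :
    IsArcAt (φ c) fun t => φ (c - t) := by
  refine ⟨by simp, L / 2, half_pos h.1, fun s hs t ht => ?_⟩
  have e : c - s - (c - t) = -(s - t) := by ring
  dsimp only
  rw [h.2.2.2 (c - s) (c - t), e, abs_neg]
  rw [e, abs_neg, abs_le]
  constructor <;> linarith [hs.1, hs.2, ht.1, ht.2]

theorem CircleParam.not_arcEquiv (h : CircleParam S L φ) (c : ℝ) :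
    ¬ ArcEquiv (fun t => φ (c + t)) fun t => φ (c - t) := by
  rintro ⟨ε, hε, heq⟩
  set t := min ε (L / 4) with ht
  have htpos : 0 < t := lt_min hε (by linarith [h.1])
  have htL : t ≤ L / 4 := min_le_right _ _
  have e : |c + t - (c - t)| = 2 * t := by
    rw [show c + t - (c - t) = 2 * t by ring, abs_of_pos (by linarith)]
  have hd := h.2.2.2 (c + t) (c - t) (by rw [e]; linarith)
  have hz := heq t ⟨htpos.le, min_le_left _ _⟩
  dsimp only at hz
  rw [hz, dist_self, e] at hd
  linarith

/-- Two parameters of the same point at distance at most one period differ by a period. -/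
theorem CircleParam.eq_add_period (h : CircleParam S L φ) {b c : ℝ} (hcb : c < b)
    (hbc : b ≤ c + L) (heq : φ b = φ c) : b = c + L := by
  have hlt : L / 2 < b - c := by
    by_contra! hle
    have hd := h.2.2.2 b c (by rwa [abs_of_pos (sub_pos.2 hcb)])
    rw [heq, dist_self, abs_of_pos (sub_pos.2 hcb)] at hd
    linarith
  have e : |b - (c + L)| = c + L - b := by rw [abs_sub_comm, abs_of_nonneg (by linarith)]
  have hd := h.2.2.2 b (c + L) (by rw [e]; linarith)
  rw [h.2.1, heq, dist_self, e] at hd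
  linarith

/-- A closed set meeting a circle but missing one of its parameters `t₀` misses a maximal open
arc around `t₀`, of length at most one period. -/
theorem CircleParam.exists_gap (h : CircleParam S L φ) {X : Set Γ} (hX : IsClosed X)
    (hne : (X ∩ S).Nonempty) {t₀ : ℝ} (ht₀ : φ t₀ ∉ X) :
    ∃ c b, c < b ∧ b ≤ c + L ∧ φ c ∈ X ∧ φ b ∈ X ∧ ∀ t, c < t → t < b → φ t ∉ X := by
  obtain ⟨hL, hper, hrange, -⟩ := id h
  have hA : IsClosed (φ ⁻¹' X) := hX.preimage h.continuous
  obtain ⟨x, hxX, hxS⟩ := hne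
  rw [← hrange] at hxS
  obtain ⟨u, rfl⟩ := hxS
  have hz : ∀ n : ℤ, φ (u + n * L) = φ u := fun n =>
    Function.Periodic.int_mul hper n u
  obtain ⟨n, hn⟩ := exists_int_gt ((t₀ - u) / L)
  obtain ⟨m, hm⟩ := exists_int_lt ((t₀ - u) / L)
  rw [div_lt_iff₀ hL] at hn
  rw [lt_div_iff₀ hL] at hm
  have hU : (φ ⁻¹' X ∩ Set.Ici t₀).Nonempty :=
    ⟨u + n * L, by simpa [hz] using hxX, by rw [Set.mem_Ici]; linarith⟩
  have hD : (φ ⁻¹' X ∩ Set.Iic t₀).Nonempty :=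
    ⟨u + m * L, by simpa [hz] using hxX, by rw [Set.mem_Iic]; linarith⟩
  have bU : BddBelow (φ ⁻¹' X ∩ Set.Ici t₀) := ⟨t₀, fun y hy => hy.2⟩
  have bD : BddAbove (φ ⁻¹' X ∩ Set.Iic t₀) := ⟨t₀, fun y hy => hy.2⟩
  obtain ⟨hbX, hbt⟩ := (hA.inter isClosed_Ici).csInf_mem hU bU
  obtain ⟨hcX, hct⟩ := (hA.inter isClosed_Iic).csSup_mem hD bD
  set b := sInf (φ ⁻¹' X ∩ Set.Ici t₀)
  set c := sSup (φ ⁻¹' X ∩ Set.Iic t₀)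
  have hb : t₀ < b := lt_of_le_of_ne hbt fun e => ht₀ (e ▸ hbX)
  have hc : c < t₀ := lt_of_le_of_ne hct fun e => ht₀ (e ▸ hcX)
  have hcL : c + L ∈ φ ⁻¹' X := by
    rw [Set.mem_preimage, hper]
    exact hcX
  refine ⟨c, b, hc.trans hb, ?_, hcX, hbX, fun t hct' htb htX => ?_⟩
  · refine csInf_le bU ⟨hcL, ?_⟩
    by_contra hlt
    rw [Set.mem_Ici, not_le] at hlt
    have := le_csSup bD ⟨hcL, Set.mem_Iic.2 hlt.le⟩
    linarith
  · rcases le_total t t₀ with hle | hle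
    · exact (le_csSup bD ⟨htX, hle⟩).not_gt hct'
    · exact (csInf_le bU ⟨htX, hle⟩).not_gt htb

/-- If a closed set `X` meets a circle `S` without containing it, then for every point `Q`
either two tangent directions leave `X` at some point of `X ∩ S`, or one does at some point of
`X ∩ S` other than `Q`. -/
theorem IsCircleSet.exists_arcs_leaving (hS : IsCircleSet S) {X : Set Γ} (hX : IsClosed X)
    (hne : (X ∩ S).Nonempty) {p : Γ} (hpS : p ∈ S) (hpX : p ∉ X) (Q : Γ) :
    ∃ P ∈ X ∩ S, ∃ (n : ℕ) (τ : Fin n → ℝ → Γ), (∀ i, IsArcAt P (τ i)) ∧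
      (∀ i, ArcLeaves X (τ i)) ∧ Pairwise (fun i j => ¬ ArcEquiv (τ i) (τ j)) ∧
      1 ≤ n ∧ (P = Q → 2 ≤ n) := by
  obtain ⟨L, φ, h⟩ := hS
  have hmem : ∀ t, φ t ∈ S := fun t => h.2.2.1 ▸ Set.mem_range_self t
  obtain ⟨t₀, rfl⟩ : p ∈ Set.range φ := h.2.2.1.symm ▸ hpS
  obtain ⟨c, b, hcb, hbc, hcX, hbX, hgap⟩ := h.exists_gap hX hne hpX
  have lc : ArcLeaves X fun t => φ (c + t) :=
    ⟨(b - c) / 2, by linarith, fun t ht => hgap _ (by linarith [ht.1]) (by linarith [ht.2])⟩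
  have lb : ArcLeaves X fun t => φ (b - t) :=
    ⟨(b - c) / 2, by linarith, fun t ht => hgap _ (by linarith [ht.2]) (by linarith [ht.1])⟩
  by_cases hbceq : φ b = φ c
  · obtain rfl := h.eq_add_period hcb hbc hbceq
    have hshift : (fun t => φ (c + L - t)) = fun t => φ (c - t) := by
      funext t
      rw [show c + L - t = c - t + L by ring, h.2.1]
    rw [hshift] at lb
    refine ⟨φ c, ⟨hcX, hmem c⟩, 2, ![fun t => φ (c + t), fun t => φ (c - t)], ?_, ?_, ?_,
      by norm_num, fun _ => le_rfl⟩
    · simp [Fin.forall_fin_two, h.isArcAt_add, h.isArcAt_sub]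
    · simp [Fin.forall_fin_two, lc, lb]
    · have hne := h.not_arcEquiv c
      intro i j hij
      fin_cases i <;> fin_cases j
      · exact absurd rfl hij
      · exact hne
      · exact fun e => hne e.symm
      · exact absurd rfl hij
  · by_cases hcQ : φ c = Q
    · refine ⟨φ b, ⟨hbX, hmem b⟩, 1, fun _ t => φ (b - t), fun _ => h.isArcAt_sub b,
        fun _ => lb, Subsingleton.pairwise, le_rfl, fun e => absurd (e.trans hcQ.symm) hbceq⟩
    · exact ⟨φ c, ⟨hcX, hmem c⟩, 1, fun _ t => φ (c + t), fun _ => h.isArcAt_add c,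
        fun _ => lc, Subsingleton.pairwise, le_rfl, fun e => absurd e hcQ⟩

end Circles

section Ranks

variable {Γ : Type*} [MetricSpace Γ]

theorem EquivEffective.of_sub {D E : Divisor Γ} (hE : Effective E)
    (h : EquivEffective Γ (D - E)) : EquivEffective Γ D := by
  obtain ⟨D', hD', f, hf, hord⟩ := h
  refine ⟨D' + E, fun P => add_nonneg (hD' P) (hE P), f, hf, fun P => ?_⟩
  have e : (D' + E) P - D P = D' P - (D - E) P := by
    rw [Finsupp.add_apply, Finsupp.sub_apply]
    ring
  rw [e]
  exact hord P

theorem divRank_eq_neg_one [Nonempty Γ] {D : Divisor Γ} (h : ¬ EquivEffective Γ D) :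
    divRank Γ D = -1 := by
  have hempty : {n : ℤ | ∃ r : ℕ, n = (r : ℤ) ∧ RankGE Γ D r} = ∅ := by
    refine Set.eq_empty_of_forall_notMem ?_
    rintro _ ⟨r, -, hr⟩
    obtain ⟨P⟩ := ‹Nonempty Γ›
    have hE : Effective (Finsupp.single P (r : ℤ)) := fun Q => by
      classical
      rw [Finsupp.single_apply]
      split_ifs <;> simp
    exact h ((hr _ hE (by simp [divDeg])).of_sub hE)
  rw [divRank, hempty, insert_empty_eq, csSup_singleton]

/-- If `D + P₀` is `P₀`-reduced and `P₀` is not in the support of `D`, then `D - P₀` is not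
equivalent to an effective divisor. -/
theorem IsReducedDivisor.not_equivEffective [CompactSpace Γ] {D : Divisor Γ} {P₀ : Γ}
    (hD : IsReducedDivisor Γ (D + Finsupp.single P₀ 1) P₀) (hP₀ : D P₀ = 0) :
    ¬ EquivEffective Γ (D - Finsupp.single P₀ 1) := by
  rintro ⟨D', hD', f, ⟨hf, -⟩, hord⟩
  obtain ⟨M, -, hM⟩ := isCompact_univ.exists_isMaxOn ⟨P₀, Set.mem_univ _⟩ hf.continuousOn
  replace hM : ∀ x, f x ≤ f M := fun x => hM (Set.mem_univ x)
  have hclosed : IsClosed {x | f x = f M} := isClosed_eq hf continuous_const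
  have hnot : P₀ ∉ {x | f x = f M} := by
    intro hmem
    have h := (hord P₀).le_neg_of_leaves_argmax (n := 0) (σ := Fin.elim0) (fun x => hmem ▸ hM x)
      (fun i => i.elim0) (fun i => i.elim0) (fun i => i.elim0)
    have := hD' P₀
    simp only [Finsupp.sub_apply, Finsupp.single_eq_same, hP₀] at h
    push_cast at h
    linarith
  obtain ⟨P, hPX, n, τ, harc, hl, hpw, hn⟩ := hD.2 _ hclosed ⟨M, rfl⟩ hnot
  have hPM : f P = f M := hclosed.frontier_subset hPX
  have hne : P ≠ P₀ := fun e => hnot (e ▸ hPM)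
  have h := (hord P).le_neg_of_leaves_argmax (fun x => hPM ▸ hM x) harc
    (by rwa [hPM]) hpw
  have := hD' P
  simp only [Finsupp.add_apply, Finsupp.sub_apply, Finsupp.single_eq_of_ne hne] at h hn
  linarith

end Ranks

namespace ChainOfLoops

variable {a : ℕ}

/-- A point lying on two loops of the chain is one of the points `w_i`. -/
theorem eq_w_of_mem_loop (C : ChainOfLoops a) {i j : ℕ} (hi : i ∈ Finset.Icc 1 a)
    (hj : j ∈ Finset.Icc 1 a) (hij : i < j) {P : C.Γ} (hPi : P ∈ C.loop i) (hPj : P ∈ C.loop j) :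
    j = i + 1 ∧ P = C.w i := by
  rw [Finset.mem_Icc] at hi hj
  obtain rfl | h := (Nat.succ_le_of_lt hij).eq_or_lt
  · refine ⟨rfl, ?_⟩
    have : P ∈ C.loop i ∩ C.loop (i + 1) := ⟨hPi, hPj⟩
    rwa [C.chainMeet i (Finset.mem_Icc.2 ⟨hi.1, by omega⟩)] at this
  · have : P ∈ C.loop i ∩ C.loop j := ⟨hPi, hPj⟩
    rw [C.chainDisj i (Finset.mem_Icc.2 hi) j (Finset.mem_Icc.2 hj) (by omega)] at this
    exact this.elim

/-- A point of a loop different from the points `w_j` lies on no other loop. -/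
theorem eq_of_mem_loop {C : ChainOfLoops a} {R : ℕ → C.Γ}
    (hR : ∀ i ∈ Finset.Icc 1 a, R i ∈ C.loop i)
    (hRw : ∀ i ∈ Finset.Icc 1 a,
      (2 ≤ i → R i ≠ C.w (i - 1)) ∧ (i ≤ a - 1 → R i ≠ C.w i))
    {i j : ℕ} (hi : i ∈ Finset.Icc 1 a) (hj : j ∈ Finset.Icc 1 a)
    (h : R j ∈ C.loop i) : j = i := by
  have hi' := Finset.mem_Icc.1 hi
  have hj' := Finset.mem_Icc.1 hj
  rcases lt_trichotomy j i with hlt | heq | hlt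
  · obtain ⟨rfl, hw⟩ := C.eq_w_of_mem_loop hj hi hlt (hR j hj) h
    exact absurd hw ((hRw j hj).2 (by omega))
  · exact heq
  · obtain ⟨rfl, hw⟩ := C.eq_w_of_mem_loop hi hj hlt h (hR j hj)
    exact absurd hw ((hRw (i + 1) hj).1 (by omega))

open Classical in
/-- On the `i`-th loop, the divisor `∑ R_j` is the divisor `R_i`. -/
theorem sum_single_apply {C : ChainOfLoops a} {R : ℕ → C.Γ}
    (hR : ∀ i ∈ Finset.Icc 1 a, R i ∈ C.loop i)
    (hRw : ∀ i ∈ Finset.Icc 1 a,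
      (2 ≤ i → R i ≠ C.w (i - 1)) ∧ (i ≤ a - 1 → R i ≠ C.w i))
    {i : ℕ} (hi : i ∈ Finset.Icc 1 a) {P : C.Γ} (hP : P ∈ C.loop i) :
    (∑ j ∈ Finset.Icc 1 a, Finsupp.single (R j) (1 : ℤ)) P = if P = R i then 1 else 0 := by
  rw [Finsupp.finsetSum_apply, Finset.sum_eq_single i]
  · rw [Finsupp.single_apply]
    simp only [eq_comm]
  · intro j hj hji
    refine Finsupp.single_eq_of_ne fun e => hji ?_
    exact eq_of_mem_loop hR hRw hi hj (e ▸ hP)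
  · exact fun h => absurd hi h

theorem isReducedDivisor_sum_add {C : ChainOfLoops a} {R : ℕ → C.Γ}
    (hR : ∀ i ∈ Finset.Icc 1 a, R i ∈ C.loop i)
    (hRw : ∀ i ∈ Finset.Icc 1 a,
      (2 ≤ i → R i ≠ C.w (i - 1)) ∧ (i ≤ a - 1 → R i ≠ C.w i)) :
    IsReducedDivisor C.Γ
      ((∑ i ∈ Finset.Icc 1 a, Finsupp.single (R i) 1) + Finsupp.single C.vg' 1) C.vg' := by
  classical
  refine ⟨fun P hP => ?_, fun X hX hXne hvX => ?_⟩
  · rw [Finsupp.add_apply, Finsupp.single_eq_of_ne hP, add_zero, Finsupp.finsetSum_apply]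
    refine Finset.sum_nonneg fun i _ => ?_
    rw [Finsupp.single_apply]
    split_ifs <;> simp
  obtain ⟨x, hx⟩ := hXne
  have hxc : x ∈ ⋃ i ∈ Finset.Icc 1 a, C.loop i := C.cover ▸ Set.mem_univ x
  simp only [Set.mem_iUnion] at hxc
  obtain ⟨k, hk, hxk⟩ := hxc
  let T := (Finset.Icc 1 a).filter fun i => (X ∩ C.loop i).Nonempty
  have hT : T.Nonempty := ⟨k, Finset.mem_filter.2 ⟨hk, x, hx, hxk⟩⟩
  obtain ⟨i, hiT, hlast⟩ : ∃ i ∈ T, ∀ j ∈ T, j ≤ i :=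
    ⟨T.max' hT, T.max'_mem hT, fun j hj => T.le_max' j hj⟩
  obtain ⟨hi, hne⟩ := Finset.mem_filter.1 hiT
  have hi' := Finset.mem_Icc.1 hi
  obtain ⟨p, hpS, hpX⟩ : ∃ p ∈ C.loop i, p ∉ X := by
    obtain heq | hlt := hi'.2.eq_or_lt
    · exact ⟨C.vg', heq ▸ C.hvg', hvX⟩
    · have hw : C.w i ∈ C.loop i ∩ C.loop (i + 1) := by
        rw [C.chainMeet i (Finset.mem_Icc.2 ⟨hi'.1, by omega⟩)]
        rfl
      refine ⟨C.w i, hw.1, fun hwX => ?_⟩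
      have := hlast (i + 1)
        (Finset.mem_filter.2 ⟨Finset.mem_Icc.2 ⟨by omega, hlt⟩, C.w i, hwX, hw.2⟩)
      omega
  obtain ⟨P, ⟨hPX, hPi⟩, n, τ, harc, hl, hpw, hn, hnR⟩ :=
    (C.circle i hi).exists_arcs_leaving hX hne hpS hpX (R i)
  refine ⟨P, mem_frontier_of_arcLeaves hPX (harc ⟨0, hn⟩) (hl ⟨0, hn⟩), n, τ, harc, hl, hpw, ?_⟩
  have hPv : P ≠ C.vg' := fun e => hvX (e ▸ hPX)
  rw [Finsupp.add_apply, Finsupp.single_eq_of_ne hPv, add_zero, sum_single_apply hR hRw hi hPi]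
  split_ifs with hPR
  · exact_mod_cast hnR hPR
  · exact_mod_cast hn

end ChainOfLoops

/-- In the chain of loops `Γ₀` with marked points `v_g ∈ γ₁`,
`v_{g-1} ∈ γ_a` : for points `R₁ ∈ γ₁ \ {v_g, w₁}`, `R_i ∈ γ_i \ {w_{i-1}, w_i}`
(`2 ≤ i ≤ a - 1`), `R_a ∈ γ_a \ {w_{a-1}, v_{g-1}}`, the divisor
`R₁ + ⋯ + R_a + v_{g-1}` is `v_{g-1}`-reduced; consequently
`rk(R₁ + ⋯ + R_a - v_{g-1}) = -1`, i.e. `R₁ + ⋯ + R_a - v_{g-1}` is not linearly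
equivalent to an effective divisor. -/
theorem statement14 (a : ℕ) (C : ChainOfLoops a) (R : ℕ → C.Γ)
    (hR : ∀ i ∈ Finset.Icc 1 a, R i ∈ C.loop i)
    (hR1 : R 1 ≠ C.vg) (hRa : R a ≠ C.vg')
    (hRw : ∀ i ∈ Finset.Icc 1 a,
      (2 ≤ i → R i ≠ C.w (i - 1)) ∧ (i ≤ a - 1 → R i ≠ C.w i)) :
    IsReducedDivisor C.Γ
      ((∑ i ∈ Finset.Icc 1 a, Finsupp.single (R i) 1) + Finsupp.single C.vg' 1)
      C.vg' ∧
    divRank C.Γ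
      ((∑ i ∈ Finset.Icc 1 a, Finsupp.single (R i) 1) - Finsupp.single C.vg' 1) = -1 ∧
    ¬ EquivEffective C.Γ
      ((∑ i ∈ Finset.Icc 1 a, Finsupp.single (R i) 1) - Finsupp.single C.vg' 1) := by
  have hred := ChainOfLoops.isReducedDivisor_sum_add hR hRw
  have hv : (∑ i ∈ Finset.Icc 1 a, Finsupp.single (R i) (1 : ℤ)) C.vg' = 0 := by
    rw [ChainOfLoops.sum_single_apply hR hRw (Finset.mem_Icc.2 ⟨C.ha, le_rfl⟩) C.hvg',
      if_neg hRa.symm]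
  have : CompactSpace C.Γ := C.graph.1
  have : Nonempty C.Γ := ⟨C.vg'⟩
  have hnot := hred.not_equivEffective hv
  exact ⟨hred, divRank_eq_neg_one hnot, hnot⟩
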